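/- Let S be a quasi-orthodox quasi completely regular semiring. Then D*⁺ = H*⁺ ∘ 𝒴 (relational composition). -/

import Mathlib

/-- A "semiring" in the sense of the paper: both reducts are semigroups
(no commutativity, no identities) and multiplication distributes over
addition on both sides. -/
class PSemiring (S : Type*) extends AddSemigroup S, Semigroup S where
  left_distrib : ∀ a b c : S, a * (b + c) = a * b + a * c
  right_distrib : ∀ a b c : S, (a + b) * c = a * c + b * c

namespace PSemiring

variable {S : Type*} [PSemiring S]

/-- `nmul n a` is the `(n+1)`-fold sum `a + ⋯ + a`; thus the positive
multiple `m·a` of the paper is `nmul (m-1) a`. -/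
def nmul : ℕ → S → S
  | 0, a => a
  | n + 1, a => nmul n a + a

/-- `a` is additively regular. -/
def AddRegular (a : S) : Prop := ∃ x, a + x + a = a

/-- `a` is a completely regular element. -/
def CompletelyRegularElem (a : S) : Prop :=
  ∃ x, a = a + x + a ∧ a + x = x + a ∧ a * (a + x) = a + x

/-- `S` is a quasi completely regular semiring. -/
def QuasiCompletelyRegular (S : Type*) [PSemiring S] : Prop :=
  ∀ a : S, ∃ n : ℕ, CompletelyRegularElem (nmul n a)

/-- `S` is a completely regular semiring. -/
def CompletelyRegularSemiring (S : Type*) [PSemiring S] : Prop :=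
  ∀ a : S, CompletelyRegularElem a

/-- `e` is an additive idempotent (i.e. `e ∈ E⁺(S)`). -/
def AddIdem (e : S) : Prop := e + e = e

/-- `V⁺(a)`, the set of additive inverses of `a`. -/
def Vplus (a : S) : Set S := {x | a + x + a = a ∧ x + a + x = x}

/-- `{a} ∪ (S + a)`. -/
def lset (a : S) : Set S := insert a {x | ∃ s, x = s + a}

/-- `{a} ∪ (a + S)`. -/
def rset (a : S) : Set S := insert a {x | ∃ s, x = a + s}

/-- `{a} ∪ (S + a) ∪ (a + S) ∪ (S + a + S)`. -/
def jset (a : S) : Set S :=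
  insert a ({x | ∃ s, x = s + a} ∪ {x | ∃ s, x = a + s} ∪ {x | ∃ s t, x = s + a + t})

/-- Green's relation `L⁺` on the additive reduct. -/
def GreenL (a b : S) : Prop := lset a = lset b

/-- Green's relation `R⁺` on the additive reduct. -/
def GreenR (a b : S) : Prop := rset a = rset b

/-- Green's relation `J⁺` on the additive reduct. -/
def GreenJ (a b : S) : Prop := jset a = jset b

/-- `n` is the least index such that the `(n+1)`-fold sum of `a` is additively
regular, i.e. `(n+1)·a` is the least additively regular positive multiple. -/
def LeastReg (a : S) (n : ℕ) : Prop :=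
  AddRegular (nmul n a) ∧ ∀ m < n, ¬ AddRegular (nmul m a)

/-- The relation `L*⁺`. -/
def LStar (a b : S) : Prop :=
  ∃ p q, LeastReg a p ∧ LeastReg b q ∧ GreenL (nmul p a) (nmul q b)

/-- The relation `R*⁺`. -/
def RStar (a b : S) : Prop :=
  ∃ p q, LeastReg a p ∧ LeastReg b q ∧ GreenR (nmul p a) (nmul q b)

/-- The relation `J*⁺`. -/
def JStar (a b : S) : Prop :=
  ∃ p q, LeastReg a p ∧ LeastReg b q ∧ GreenJ (nmul p a) (nmul q b)

/-- `H*⁺ = L*⁺ ∩ R*⁺`. -/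
def HStar (a b : S) : Prop := LStar a b ∧ RStar a b

/-- `D*⁺ = L*⁺ ∘ R*⁺` (relational composition). -/
def DStar (a b : S) : Prop := ∃ c, LStar a c ∧ RStar c b

/-- `z = 0_a`: `z = na + x` where `n` is the least positive integer with `na`
completely regular and `x` is the (unique) element with `na = na+x+na`,
`x = x+na+x` and `na+x = x+na`. -/
def IsZeroOf (a z : S) : Prop :=
  ∃ n x, (CompletelyRegularElem (nmul n a) ∧
      ∀ m < n, ¬ CompletelyRegularElem (nmul m a)) ∧
    nmul n a = nmul n a + x + nmul n a ∧ x = x + nmul n a + x ∧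
    nmul n a + x = x + nmul n a ∧ z = nmul n a + x

/-- The relation `𝒴`, relative to a choice `z` of the map `a ↦ 0_a`. -/
def Yrel (z : S → S) (a b : S) : Prop := Vplus (a + z a) = Vplus (b + z b)

/-- A (semiring) congruence. -/
structure IsCong (r : S → S → Prop) : Prop where
  refl : ∀ a, r a a
  symm : ∀ {a b}, r a b → r b a
  trans : ∀ {a b c}, r a b → r b c → r a c
  addl : ∀ (c : S) {a b}, r a b → r (c + a) (c + b)
  addr : ∀ (c : S) {a b}, r a b → r (a + c) (b + c)
  mull : ∀ (c : S) {a b}, r a b → r (c * a) (c * b)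
  mulr : ∀ (c : S) {a b}, r a b → r (a * c) (b * c)

/-- `r` is a b-lattice congruence: `S/r` is a b-lattice. -/
def IsBLatticeCong (r : S → S → Prop) : Prop :=
  IsCong r ∧ (∀ a : S, r (a * a) a) ∧ (∀ a : S, r (a + a) a) ∧
    ∀ a b : S, r (a + b) (b + a)

/-- `r` is the least b-lattice congruence. -/
def IsLeastBLatticeCong (r : S → S → Prop) : Prop :=
  IsBLatticeCong r ∧ ∀ r', IsBLatticeCong r' → ∀ a b, r a b → r' a b

/-- `r` is a skew-ring congruence: `S/r` is a semiring whose additive reduct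
is a group (expressed by solvability of both translation equations). -/
def IsSkewRingCong (r : S → S → Prop) : Prop :=
  IsCong r ∧ ∀ a b : S, (∃ x, r (a + x) b) ∧ ∃ y, r (y + a) b

/-- `r` is the least skew-ring congruence. -/
def IsLeastSkewRingCong (r : S → S → Prop) : Prop :=
  IsSkewRingCong r ∧ ∀ r', IsSkewRingCong r' → ∀ a b, r a b → r' a b

/-- `η` is a b-lattice-of-skew-rings congruence: `S/η` admits a congruence `ξ`
(given here as a congruence on `S` containing `η`) such that `(S/η)/ξ` is a
b-lattice and every `ξ`-class of `S/η` is a subsemiring whose additive reduct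
is a group. -/
def IsBLSRCong (η : S → S → Prop) : Prop :=
  IsCong η ∧ ∃ ξ : S → S → Prop, IsCong ξ ∧ (∀ a b, η a b → ξ a b) ∧
    (∀ a : S, ξ (a * a) a) ∧ (∀ a : S, ξ (a + a) a) ∧
    (∀ a b : S, ξ (a + b) (b + a)) ∧
    (∀ a b, ξ a b → ξ (a + b) a ∧ ξ (a * b) a) ∧
    ∀ a b, ξ a b → (∃ x, ξ x a ∧ η (a + x) b) ∧ ∃ y, ξ y a ∧ η (y + a) b

/-- `ν` is the least b-lattice-of-skew-rings congruence. -/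
def IsLeastBLSRCong (ν : S → S → Prop) : Prop :=
  IsBLSRCong ν ∧ ∀ η, IsBLSRCong η → ∀ a b, ν a b → η a b

/-- `r` is a completely regular semiring congruence: `S/r` is completely
regular. -/
def IsCRCong (r : S → S → Prop) : Prop :=
  IsCong r ∧ ∀ a : S, ∃ x, r a (a + x + a) ∧ r (a + x) (x + a) ∧
    r (a * (a + x)) (a + x)

/-- `ρ` is the least completely regular semiring congruence. -/
def IsLeastCRCong (r : S → S → Prop) : Prop :=
  IsCRCong r ∧ ∀ r', IsCRCong r' → ∀ a b, r a b → r' a b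

/-- `S` is quasi-orthodox. -/
def QuasiOrthodox (S : Type*) [PSemiring S] : Prop :=
  ∀ e f : S, AddIdem e → AddIdem f →
    ∃ n : ℕ, nmul n (e + f) = nmul (n + 1) (e + f)

/-- `S` is a completely Archimedean semiring. -/
def CompletelyArchimedean (S : Type*) [PSemiring S] : Prop :=
  QuasiCompletelyRegular S ∧ ∀ a b : S, JStar a b

/-- `r` is the least congruence containing the relation `τ`. -/
def IsLeastCongContaining (τ r : S → S → Prop) : Prop :=
  IsCong r ∧ (∀ a b, τ a b → r a b) ∧
    ∀ r', IsCong r' → (∀ a b, τ a b → r' a b) → ∀ a b, r a b → r' a b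

/-- `r` is a generalized additive idempotent pure congruence (purity part). -/
def GenAddIdemPure (r : S → S → Prop) : Prop :=
  ∀ a e : S, AddIdem e → r a e → ∃ n : ℕ, nmul n a = nmul (n + 1) a

/-- `τ^e`: `a = x + c + y`, `b = x + d + y` for some `(c,d) ∈ τ`, where each of
`x`, `y` may also be absent (i.e. `x, y ∈ S⁰`). -/
def relE (τ : S → S → Prop) (a b : S) : Prop :=
  ∃ c d, τ c d ∧ ((a = c ∧ b = d) ∨ (∃ x, a = x + c ∧ b = x + d) ∨
    (∃ y, a = c + y ∧ b = d + y) ∨ ∃ x y, a = x + c + y ∧ b = x + d + y)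

/-- `τ^♮`: the transitive closure of `(τ ∪ τ⁻¹ ∪ ε)^e`. -/
def natClosure (τ : S → S → Prop) : S → S → Prop :=
  Relation.TransGen (relE (fun a b => τ a b ∨ τ b a ∨ a = b))

/-- `u` lies in the maximal additive subgroup with identity `z`. -/
def InAddGroup (u z : S) : Prop :=
  u + z = u ∧ z + u = u ∧ (∃ y, u + y = z) ∧ ∃ y, y + u = z

/-- `e` and `f` are mutually inverse (generators of a rectangular band, when idempotent). -/
def RectPair (e f : S) : Prop := e + f + e = e ∧ f + e + f = f

theorem nmul_comm (n : ℕ) (a : S) : a + nmul n a = nmul n a + a := by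
  induction n with
  | zero => rfl
  | succ n ih => simp only [nmul]; rw [← add_assoc, ih]

theorem nmul_add_nmul (m n : ℕ) (a : S) : nmul m a + nmul n a = nmul (m + n + 1) a := by
  induction n with
  | zero => rfl
  | succ n ih => simp only [nmul] at ih ⊢; rw [← add_assoc, ih]; rfl

theorem nmul_nmul (m n : ℕ) (a : S) : nmul m (nmul n a) = nmul (m * n + m + n) a := by
  induction m with
  | zero => simp [nmul]
  | succ m ih =>
    simp only [nmul]
    rw [ih, nmul_add_nmul]
    congr 1
    ring

theorem nmul_mul (n : ℕ) (a b : S) : nmul n a * b = nmul n (a * b) := by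
  induction n with
  | zero => rfl
  | succ n ih => simp only [nmul]; rw [right_distrib, ih]

theorem mul_nmul (n : ℕ) (a b : S) : a * nmul n b = nmul n (a * b) := by
  induction n with
  | zero => rfl
  | succ n ih => simp only [nmul]; rw [left_distrib, ih]

theorem AddIdem.nmul_eq {e : S} (he : AddIdem e) (n : ℕ) : nmul n e = e := by
  induction n with
  | zero => rfl
  | succ n ih => simp only [nmul]; rw [ih, he]

theorem AddIdem.mul_left {e : S} (he : AddIdem e) (a : S) : AddIdem (a * e) := by
  unfold AddIdem at *; rw [← left_distrib, he]

theorem AddIdem.mul_right {e : S} (he : AddIdem e) (a : S) : AddIdem (e * a) := by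
  unfold AddIdem at *; rw [← right_distrib, he]

theorem AddIdem.inAddGroup {e : S} (he : AddIdem e) : InAddGroup e e :=
  ⟨he, he, ⟨e, he⟩, ⟨e, he⟩⟩

theorem AddIdem.mul_self (hS : QuasiCompletelyRegular S) {e : S} (he : AddIdem e) :
    e * e = e := by
  obtain ⟨n, x, h1, h2, h3⟩ := hS e
  rw [he.nmul_eq] at h1 h2 h3
  have : e + x = e := by
    unfold AddIdem at he
    grind
  rwa [this] at h3

theorem InAddGroup.addIdem {u w : S} (h : InAddGroup u w) : AddIdem w := by
  obtain ⟨-, h2, ⟨y, hy⟩, -⟩ := h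
  calc w + w = w + u + y := by rw [add_assoc, hy]
    _ = w := by rw [h2, hy]

theorem InAddGroup.addRegular {u w : S} (h : InAddGroup u w) : AddRegular u := by
  obtain ⟨h1, h2, ⟨y, hy⟩, -⟩ := h
  exact ⟨y, by grind⟩

theorem InAddGroup.nmul {u w : S} (h : InAddGroup u w) (n : ℕ) : InAddGroup (nmul n u) w := by
  induction n with
  | zero => exact h
  | succ n ih =>
    obtain ⟨h1, h2, ⟨y, hy⟩, ⟨t, ht⟩⟩ := h
    obtain ⟨k1, k2, ⟨y', hy'⟩, ⟨t', ht'⟩⟩ := ih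
    refine ⟨?_, ?_, ⟨y + y', ?_⟩, ⟨t + t', ?_⟩⟩ <;> simp only [PSemiring.nmul]
    · grind
    · grind
    · grind
    · grind

theorem InAddGroup.unique {u w w' : S} (h : InAddGroup u w) (h' : InAddGroup u w') :
    w = w' := by
  obtain ⟨h1, -, ⟨y, hy⟩, -⟩ := h
  obtain ⟨-, k2, -, ⟨t', ht'⟩⟩ := h'
  have e1 : w' + w = w := by rw [← hy, ← add_assoc, k2]
  have e2 : w' + w = w' := by rw [← ht', add_assoc, h1]
  rw [← e1, e2]

theorem InAddGroup.unique_nmul {a w w' : S} {m n : ℕ} (h : InAddGroup (PSemiring.nmul m a) w)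
    (h' : InAddGroup (PSemiring.nmul n a) w') : w = w' := by
  have h1 := h.nmul n
  have h2 := h'.nmul m
  rw [nmul_nmul] at h1 h2
  rw [show m * n + m + n = n * m + n + m by ring] at h2
  exact h1.unique h2

theorem IsZeroOf.exists_inAddGroup {a w : S} (h : IsZeroOf a w) :
    ∃ n, InAddGroup (nmul n a) w := by
  obtain ⟨n, x, -, h1, h2, h3, rfl⟩ := h
  refine ⟨n, ?_, h1.symm, ⟨x, rfl⟩, ⟨x, h3.symm⟩⟩
  rw [h3, ← add_assoc, ← h1]

theorem nmul_eq_add (n : ℕ) (a : S) (y : S) : ∃ t, nmul n a + y = a + t := by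
  cases n with
  | zero => exact ⟨y, rfl⟩
  | succ n => exact ⟨nmul n a + y, by simp only [nmul]; rw [← nmul_comm, add_assoc]⟩

theorem add_nmul_eq (n : ℕ) (a : S) (y : S) : ∃ t, y + nmul n a = t + a := by
  cases n with
  | zero => exact ⟨y, rfl⟩
  | succ n => exact ⟨y + nmul n a, by simp only [nmul]; rw [add_assoc]⟩

theorem IsZeroOf.add_inAddGroup {a w : S} (h : IsZeroOf a w) : InAddGroup (a + w) w := by
  obtain ⟨n, h⟩ := h.exists_inAddGroup
  have hw : w + w = w := h.addIdem
  obtain ⟨h1, h2, ⟨y, hy⟩, ⟨t, ht⟩⟩ := h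
  have hc := nmul_comm n a
  have e1 : w + a + w = a + w := by
    calc w + a + w = w + (a + nmul n a) + y := by rw [← hy]; simp only [add_assoc]
      _ = w + nmul n a + a + y := by rw [hc]; simp only [add_assoc]
      _ = a + w := by rw [h2, ← hc, add_assoc, hy]
  have e2 : w + a + w = w + a := by
    calc w + a + w = t + (nmul n a + a) + w := by rw [← ht]; simp only [add_assoc]
      _ = t + a + (nmul n a + w) := by rw [← hc]; simp only [add_assoc]
      _ = w + a := by rw [h1, add_assoc, hc, ← add_assoc, ht]
  have e3 : w + a = a + w := by rw [← e1, e2]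
  obtain ⟨y', hy'⟩ := nmul_eq_add n a y
  obtain ⟨t', ht'⟩ := add_nmul_eq n a t
  refine ⟨?_, ?_, ⟨y', ?_⟩, ⟨t', ?_⟩⟩
  · grind
  · grind
  · grind
  · grind

theorem IsZeroOf.mul_eq {a w : S} (h : IsZeroOf a w) :
    a * w = w := by
  have hw : AddIdem w := h.exists_inAddGroup.choose_spec.addIdem
  obtain ⟨n, -, ⟨⟨x, h1, h2, h3⟩, -⟩, -⟩ := id h
  have hx : InAddGroup (nmul n a) (nmul n a + x) :=
    ⟨by rw [h2, ← add_assoc, ← h1], h1.symm, ⟨x, rfl⟩, ⟨x, h2.symm⟩⟩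
  obtain ⟨m, hm⟩ := h.exists_inAddGroup
  rw [hx.unique_nmul hm, nmul_mul, (hw.mul_left a).nmul_eq] at h3
  exact h3

theorem AddRegular.inAddGroup (hS : QuasiCompletelyRegular S) {a w : S} (ha : AddRegular a)
    (h : IsZeroOf a w) : InAddGroup a w := by
  obtain ⟨x, hx⟩ := ha
  have haw := h.mul_eq
  obtain ⟨n, hn⟩ := h.exists_inAddGroup
  have hw : w + w = w := hn.addIdem
  have he : AddIdem (a + x) := by unfold AddIdem; grind
  have hf : AddIdem (x + a) := by unfold AddIdem; grind
  have hee : (a + x) * a + (a + x) * x = a + x := by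
    rw [← left_distrib, he.mul_self hS]
  have hff : (x + a) * x + (x + a) * a = x + a := by
    rw [← left_distrib, hf.mul_self hS]
  have h1 : (a + x) * a = nmul n ((a + x) * a) := ((he.mul_right a).nmul_eq n).symm
  have h2 : (x + a) * a = nmul n ((x + a) * a) := ((hf.mul_right a).nmul_eq n).symm
  obtain ⟨k1, k2, ⟨y, hy⟩, ⟨t, ht⟩⟩ := hn
  rw [← mul_nmul, ← k2, left_distrib, right_distrib a x w, haw] at h1
  rw [← mul_nmul, ← k1, left_distrib, right_distrib x a w, haw] at h2
  obtain ⟨y', hy'⟩ := nmul_eq_add n a y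
  obtain ⟨t', ht'⟩ := add_nmul_eq n a t
  refine ⟨?_, ?_, ⟨y', by rw [← hy', hy]⟩, ⟨t', by rw [← ht', ht]⟩⟩
  · have hfw : x + a + w = x + a := by rw [← hff, h2]; simp only [add_assoc, hw]
    rw [← hx, add_assoc a, add_assoc a, hfw]
  · have hew : w + (a + x) = a + x := by rw [← hee, h1]; simp only [← add_assoc, hw]
    rw [← hx, ← add_assoc, hew]

theorem greenL_iff {e f : S} (he : AddIdem e) (hf : AddIdem f) :
    GreenL e f ↔ e + f = e ∧ f + e = f := by
  unfold AddIdem at he hf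
  refine ⟨fun h => ?_, fun ⟨h1, h2⟩ => ?_⟩
  · have h1 : e ∈ lset f := h ▸ Set.mem_insert e _
    have h2 : f ∈ lset e := h ▸ Set.mem_insert f _
    simp only [lset, Set.mem_insert_iff, Set.mem_ofPred_eq] at h1 h2
    constructor
    · rcases h1 with rfl | ⟨s, rfl⟩
      · exact he
      · rw [add_assoc, hf]
    · rcases h2 with rfl | ⟨s, rfl⟩
      · exact he
      · rw [add_assoc, he]
  · ext x
    simp only [lset, Set.mem_insert_iff, Set.mem_ofPred_eq]
    constructor
    · rintro (rfl | ⟨s, rfl⟩)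
      · exact .inr ⟨x, h1.symm⟩
      · exact .inr ⟨s + e, by rw [add_assoc, h1]⟩
    · rintro (rfl | ⟨s, rfl⟩)
      · exact .inr ⟨x, h2.symm⟩
      · exact .inr ⟨s + f, by rw [add_assoc, h2]⟩

theorem greenR_iff {e f : S} (he : AddIdem e) (hf : AddIdem f) :
    GreenR e f ↔ e + f = f ∧ f + e = e := by
  unfold AddIdem at he hf
  refine ⟨fun h => ?_, fun ⟨h1, h2⟩ => ?_⟩
  · have h1 : e ∈ rset f := h ▸ Set.mem_insert e _
    have h2 : f ∈ rset e := h ▸ Set.mem_insert f _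
    simp only [rset, Set.mem_insert_iff, Set.mem_ofPred_eq] at h1 h2
    constructor
    · rcases h2 with rfl | ⟨s, rfl⟩
      · exact he
      · rw [← add_assoc, he]
    · rcases h1 with rfl | ⟨s, rfl⟩
      · exact he
      · rw [← add_assoc, hf]
  · ext x
    simp only [rset, Set.mem_insert_iff, Set.mem_ofPred_eq]
    constructor
    · rintro (rfl | ⟨s, rfl⟩)
      · exact .inr ⟨x, h2.symm⟩
      · exact .inr ⟨e + s, by rw [← add_assoc, h2]⟩
    · rintro (rfl | ⟨s, rfl⟩)
      · exact .inr ⟨x, h1.symm⟩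
      · exact .inr ⟨f + s, by rw [← add_assoc, h1]⟩

theorem InAddGroup.greenL {u w : S} (h : InAddGroup u w) : GreenL u w := by
  obtain ⟨h1, h2, -, ⟨t, ht⟩⟩ := h
  ext x
  simp only [lset, Set.mem_insert_iff, Set.mem_ofPred_eq]
  constructor
  · rintro (rfl | ⟨s, rfl⟩)
    · exact .inr ⟨x, h1.symm⟩
    · exact .inr ⟨s + u, by rw [add_assoc, h1]⟩
  · rintro (rfl | ⟨s, rfl⟩)
    · exact .inr ⟨t, ht.symm⟩
    · exact .inr ⟨s + t, by rw [add_assoc, ht]⟩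

theorem InAddGroup.greenR {u w : S} (h : InAddGroup u w) : GreenR u w := by
  obtain ⟨h1, h2, ⟨y, hy⟩, -⟩ := h
  ext x
  simp only [rset, Set.mem_insert_iff, Set.mem_ofPred_eq]
  constructor
  · rintro (rfl | ⟨s, rfl⟩)
    · exact .inr ⟨x, h2.symm⟩
    · exact .inr ⟨u + s, by rw [← add_assoc, h2]⟩
  · rintro (rfl | ⟨s, rfl⟩)
    · exact .inr ⟨y, hy.symm⟩
    · exact .inr ⟨y + s, by rw [← add_assoc, hy]⟩

theorem IsZeroOf.addIdem {a w : S} (h : IsZeroOf a w) : AddIdem w :=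
  h.exists_inAddGroup.choose_spec.addIdem

theorem IsZeroOf.eq_of_inAddGroup {a w w' : S} (h : IsZeroOf a w) (h' : InAddGroup a w') :
    w = w' := by
  obtain ⟨n, hn⟩ := h.exists_inAddGroup
  exact hn.unique_nmul (n := 0) h'

theorem exists_leastReg {a w : S} (h : IsZeroOf a w) : ∃ p, LeastReg a p := by
  classical
  have hex : ∃ n, AddRegular (nmul n a) :=
    h.exists_inAddGroup.imp fun _ hn => hn.addRegular
  exact ⟨Nat.find hex, Nat.find_spec hex, fun _ hm => Nat.find_min hex hm⟩

variable {z : S → S}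

theorem LeastReg.inAddGroup (hS : QuasiCompletelyRegular S) (hz : ∀ a, IsZeroOf a (z a))
    {a : S} {p : ℕ} (h : LeastReg a p) : InAddGroup (PSemiring.nmul p a) (z a) := by
  have h1 := h.1.inAddGroup hS (hz _)
  obtain ⟨n, hn⟩ := (hz a).exists_inAddGroup
  rwa [h1.unique_nmul hn] at h1

theorem lStar_iff (hS : QuasiCompletelyRegular S) (hz : ∀ a, IsZeroOf a (z a)) (a b : S) :
    LStar a b ↔ z a + z b = z a ∧ z b + z a = z b := by
  rw [← greenL_iff (hz a).addIdem (hz b).addIdem]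
  constructor
  · rintro ⟨p, q, hp, hq, h⟩
    exact ((hp.inAddGroup hS hz).greenL.symm.trans h).trans (hq.inAddGroup hS hz).greenL
  · intro h
    obtain ⟨p, hp⟩ := exists_leastReg (hz a)
    obtain ⟨q, hq⟩ := exists_leastReg (hz b)
    exact ⟨p, q, hp, hq,
      ((hp.inAddGroup hS hz).greenL.trans h).trans (hq.inAddGroup hS hz).greenL.symm⟩

theorem rStar_iff (hS : QuasiCompletelyRegular S) (hz : ∀ a, IsZeroOf a (z a)) (a b : S) :
    RStar a b ↔ z a + z b = z b ∧ z b + z a = z a := by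
  rw [← greenR_iff (hz a).addIdem (hz b).addIdem]
  constructor
  · rintro ⟨p, q, hp, hq, h⟩
    exact ((hp.inAddGroup hS hz).greenR.symm.trans h).trans (hq.inAddGroup hS hz).greenR
  · intro h
    obtain ⟨p, hp⟩ := exists_leastReg (hz a)
    obtain ⟨q, hq⟩ := exists_leastReg (hz b)
    exact ⟨p, q, hp, hq,
      ((hp.inAddGroup hS hz).greenR.trans h).trans (hq.inAddGroup hS hz).greenR.symm⟩

theorem hStar_iff (hS : QuasiCompletelyRegular S) (hz : ∀ a, IsZeroOf a (z a)) (a b : S) :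
    HStar a b ↔ z a = z b := by
  rw [HStar, lStar_iff hS hz, rStar_iff hS hz]
  refine ⟨fun h => h.1.1.symm.trans h.2.1, fun h => ?_⟩
  have : z b + z b = z b := (hz b).addIdem
  rw [h]
  exact ⟨⟨this, this⟩, this, this⟩

theorem RectPair.symm {e f : S} (h : RectPair e f) : RectPair f e := ⟨h.2, h.1⟩

/-- If `e L⁺ g R⁺ f` for additive idempotents in a quasi-orthodox quasi completely regular
semiring, then `e` and `f` generate a rectangular band. -/
theorem rectPair_of_middle (hS : QuasiCompletelyRegular S) (hqo : QuasiOrthodox S)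
    (hz : ∀ a, IsZeroOf a (z a)) {e f g : S} (he : AddIdem e) (hf : AddIdem f)
    (h1 : e + g = e) (h2 : g + e = g) (h3 : g + f = f) (h4 : f + g = g) : RectPair e f := by
  have hreg : AddRegular (e + f) := ⟨g, by unfold AddIdem at *; grind⟩
  have hG := hreg.inAddGroup hS (hz _)
  obtain ⟨n, hn⟩ := hqo e f he hf
  have hid : e + f = z (e + f) := by
    obtain ⟨k1, k2, -, ⟨t, ht⟩⟩ := hG.nmul n
    simp only [nmul] at hn
    calc e + f = z (e + f) + (e + f) := hG.2.1.symm
      _ = t + (nmul n (e + f) + (e + f)) := by rw [← ht, add_assoc]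
      _ = z (e + f) := by rw [← hn, ht]
  have hidem : e + f + (e + f) = e + f := by
    have : AddIdem (z (e + f)) := (hz _).addIdem
    rwa [← hid] at this
  unfold AddIdem at he hf
  constructor
  · have : e + f + g = e := by grind
    grind
  · have : g + (e + f) = f := by grind
    grind

theorem rectPair_of_inverse (hS : QuasiCompletelyRegular S) (hqo : QuasiOrthodox S)
    (hz : ∀ a, IsZeroOf a (z a)) {e f s t : S} (he : AddIdem e) (hf : AddIdem f)
    (h1 : s + t = e) (h2 : t + s = f) : RectPair e f := by
  subst h1 h2
  unfold AddIdem at he hf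
  have hreg : AddRegular (t + s + t) := ⟨s, by grind⟩
  have hG := hreg.inAddGroup hS (hz _)
  obtain ⟨k1, k2, ⟨y, hy⟩, ⟨x, hx⟩⟩ := hG
  refine rectPair_of_middle hS hqo hz (g := z (t + s + t)) he hf ?_ ?_ ?_ ?_
  · grind
  · grind
  · grind
  · grind

theorem RectPair.trans (hS : QuasiCompletelyRegular S) (hqo : QuasiOrthodox S)
    (hz : ∀ a, IsZeroOf a (z a)) {e f g : S} (he : AddIdem e) (hf : AddIdem f)
    (hg : AddIdem g) (h : RectPair e f) (h' : RectPair f g) : RectPair e g := by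
  refine rectPair_of_inverse hS hqo hz (s := e + f + (f + g)) (t := g + f + (f + e)) he hg ?_ ?_ <;>
  · unfold RectPair AddIdem at *
    grind

theorem RectPair.add_eq_left (hS : QuasiCompletelyRegular S) (hqo : QuasiOrthodox S)
    (hz : ∀ a, IsZeroOf a (z a)) {e f s : S} (hf : AddIdem f) (he : AddIdem e) (hs : AddIdem s)
    (h : RectPair f e) (h1 : f + s = f) (h2 : s + f = s) : f + e + s = f := by
  have hfs : RectPair f s := by unfold RectPair AddIdem at *; grind
  have hse : RectPair s e := RectPair.trans hS hqo hz hs hf he hfs.symm h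
  have hes : AddIdem (e + s) := by
    rw [AddIdem, ← add_assoc, hse.2]
  have hss : RectPair s (e + s) := by
    unfold AddIdem at *
    exact ⟨by rw [← add_assoc, hse.1, hs], by rw [add_assoc e, hs, hes]⟩
  have := (RectPair.trans hS hqo hz hf hs hes hfs hss).1
  rwa [add_assoc, add_assoc, h2, ← add_assoc] at this

theorem RectPair.add_eq_right (hS : QuasiCompletelyRegular S) (hqo : QuasiOrthodox S)
    (hz : ∀ a, IsZeroOf a (z a)) {e f s : S} (hf : AddIdem f) (he : AddIdem e) (hs : AddIdem s)
    (h : RectPair f e) (h1 : f + s = s) (h2 : s + f = f) : s + e + f = f := by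
  have hfs : RectPair f s := by unfold RectPair AddIdem at *; grind
  have hse : RectPair s e := RectPair.trans hS hqo hz hs hf he hfs.symm h
  have hes : AddIdem (s + e) := by
    rw [AddIdem, ← add_assoc, hse.1]
  have hss : RectPair s (s + e) := by
    unfold AddIdem at *
    exact ⟨by rw [← add_assoc, hs, hse.1], by rw [add_assoc _ s, ← add_assoc s s, hs, hes]⟩
  have := (RectPair.trans hS hqo hz hf hs hes hfs hss).1
  rwa [← add_assoc, h1] at this

theorem vplus_subset (hS : QuasiCompletelyRegular S) (hqo : QuasiOrthodox S)
    (hz : ∀ a, IsZeroOf a (z a)) {e f u : S} (he : AddIdem e) (h : RectPair f e)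
    (hu : InAddGroup u f) : Vplus u ⊆ Vplus (e + u + e) := by
  rintro x ⟨hx1, hx2⟩
  have hf := hu.addIdem
  obtain ⟨h1, h2, ⟨y, hy⟩, ⟨t, ht⟩⟩ := hu
  have ff : f + f = f := hf
  have ee : e + e = e := he
  have hs : AddIdem (x + u) := by unfold AddIdem; grind
  have hr : AddIdem (u + x) := by unfold AddIdem; grind
  have sf : x + u + f = x + u := by grind
  have fs : f + (x + u) = f := by grind
  have rf : u + x + f = f := by grind
  have fr : f + (u + x) = u + x := by grind
  have q1 : f + e + (x + u) = f := h.add_eq_left hS hqo hz hf he hs fs sf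
  have q2 : u + x + e + f = f := h.add_eq_right hS hqo hz hf he hr fr rf
  have m1 : u + e + x = u + x := by
    calc u + e + x = u + (f + e + (x + u)) + x := by grind
      _ = u + x := by rw [q1, h1]
  have m2 : x + e + u = x + u := by
    calc x + e + u = x + (u + x + e + f) + u := by grind
      _ = x + u := by rw [q2, add_assoc, h2]
  constructor
  · calc e + u + e + x + (e + u + e) = e + (u + e + x) + e + u + e := by
          simp only [add_assoc]
      _ = e + u + (x + e + u) + e := by rw [m1]; simp only [add_assoc]
      _ = e + (u + x + u) + e := by rw [m2]; simp only [add_assoc]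
      _ = e + u + e := by rw [hx1]
  · calc x + (e + u + e) + x = x + e + u + e + x := by simp only [add_assoc]
      _ = x + (u + e + x) := by rw [m2]; simp only [add_assoc]
      _ = x := by rw [m1, ← add_assoc, hx2]

theorem InAddGroup.conj {e f u : S} (h : RectPair f e) (hu : InAddGroup u f) (he : AddIdem e) :
    InAddGroup (e + u + e) e := by
  have hf : f + f = f := hu.addIdem
  obtain ⟨h1, h2, ⟨y, hy⟩, ⟨t, ht⟩⟩ := hu
  unfold AddIdem at he
  obtain ⟨p1, p2⟩ := h
  refine ⟨by grind, by grind, ⟨f + y + e, ?_⟩, ⟨e + t + f, ?_⟩⟩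
  · calc e + u + e + (f + y + e) = e + (u + f) + e + f + y + e := by
          rw [h1]; simp only [add_assoc]
      _ = e + u + (f + e + f) + y + e := by simp only [add_assoc]
      _ = e + ((u + f) + y) + e := by rw [p1]; simp only [add_assoc]
      _ = e := by rw [h1, hy, p2]
  · calc e + t + f + (e + u + e) = e + t + f + e + (f + u) + e := by
          rw [h2]; simp only [add_assoc]
      _ = e + t + (f + e + f) + u + e := by simp only [add_assoc]
      _ = e + (t + (f + u)) + e := by rw [p1]; simp only [add_assoc]
      _ = e := by rw [h2, ht, p2]

theorem vplus_conj (hS : QuasiCompletelyRegular S) (hqo : QuasiOrthodox S)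
    (hz : ∀ a, IsZeroOf a (z a)) {e f u : S} (he : AddIdem e) (h : RectPair f e)
    (hu : InAddGroup u f) : Vplus (e + u + e) = Vplus u := by
  refine Set.Subset.antisymm ?_ (vplus_subset hS hqo hz he h hu)
  have := vplus_subset hS hqo hz hu.addIdem h.symm (hu.conj h he)
  have hc : f + (e + u + e) + f = u := by
    calc f + (e + u + e) + f = f + (e + (f + (u + f)) + e) + f := by rw [hu.1, hu.2.1]
      _ = (f + e + f) + u + (f + e + f) := by simp only [add_assoc]
      _ = u := by rw [h.1, hu.2.1, hu.1]
  rwa [hc] at this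

theorem rectPair_of_vplus_eq (hS : QuasiCompletelyRegular S) (hqo : QuasiOrthodox S)
    (hz : ∀ a, IsZeroOf a (z a)) {e f u v : S} (hu : InAddGroup u e) (hv : InAddGroup v f)
    (h : Vplus u = Vplus v) : RectPair e f := by
  have he := hu.addIdem
  have hf := hv.addIdem
  obtain ⟨u1, u2, ⟨y, hy⟩, ⟨t, ht⟩⟩ := hu
  obtain ⟨v1, v2, -, ⟨t', ht'⟩⟩ := hv
  obtain ⟨x, hx⟩ : ∃ x, x ∈ Vplus u := ⟨y + e, by constructor <;> unfold AddIdem at he <;> grind⟩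
  obtain ⟨b1, b2⟩ := h ▸ hx
  obtain ⟨a1, a2⟩ := hx
  have hxu : AddIdem (x + u) := by unfold AddIdem; grind
  have hxv : AddIdem (x + v) := by unfold AddIdem; grind
  have r1 : RectPair e (x + u) := by unfold AddIdem at *; constructor <;> grind
  have r2 : RectPair (x + u) (x + v) := by constructor <;> grind
  have r3 : RectPair (x + v) f := by unfold AddIdem at *; constructor <;> grind
  exact (r1.trans hS hqo hz he hxu hxv r2).trans hS hqo hz he hxv hf r3

end PSemiring

open PSemiring

/-- In a quasi-orthodox quasi completely regular semiring,
`D*⁺ = H*⁺ ∘ 𝒴` (relational composition). -/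
theorem dstar_eq_hstar_comp_yrel {S : Type*} [PSemiring S]
    (hS : QuasiCompletelyRegular S) (hqo : QuasiOrthodox S)
    (z : S → S) (hz : ∀ a, IsZeroOf a (z a)) :
    ∀ a b : S, DStar a b ↔ ∃ c, HStar a c ∧ Yrel z c b := by
  intro a b
  have he := (hz a).addIdem
  have hf := (hz b).addIdem
  constructor
  · rintro ⟨g, hl, hr⟩
    rw [lStar_iff hS hz] at hl
    rw [rStar_iff hS hz] at hr
    have hP := (rectPair_of_middle hS hqo hz he hf hl.1 hl.2 hr.1 hr.2).symm
    have hu := (hz b).add_inAddGroup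
    have hc := hu.conj hP he
    have hzc := (hz _).eq_of_inAddGroup hc
    refine ⟨z a + (b + z b) + z a, (hStar_iff hS hz _ _).2 hzc.symm, ?_⟩
    rw [Yrel, hzc, hc.1]
    exact vplus_conj hS hqo hz he hP hu
  · rintro ⟨c, hac, hY⟩
    rw [hStar_iff hS hz] at hac
    have hP := rectPair_of_vplus_eq hS hqo hz (hz c).add_inAddGroup (hz b).add_inAddGroup hY
    rw [← hac] at hP
    obtain ⟨p1, p2⟩ := hP
    have hd : AddIdem (z b + z a) := by
      unfold AddIdem
      rw [← add_assoc, p2]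
    have hzd := (hz _).eq_of_inAddGroup hd.inAddGroup
    unfold AddIdem at he hf
    refine ⟨z b + z a, (lStar_iff hS hz _ _).2 ?_, (rStar_iff hS hz _ _).2 ?_⟩ <;> rw [hzd]
    · exact ⟨by rw [← add_assoc, p1], by rw [add_assoc, he]⟩
    · exact ⟨p2, by rw [← add_assoc, hf]⟩
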